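/- Let N ≥ 2, let Ω ⊂ ℝ^N be a bounded domain with C³ boundary and unit volume, and let p ∈ (1, p_N). Then λ_+(Ω, p) > λ₀(Ω, p), where λ₀(Ω, p) = Λ(Ω, 2p)/p; in particular, for every λ with 0 ≤ λ ≤ λ₀(Ω, p), every solution (α, ψ) of (P)_λ on Ω satisfies α > 0. -/

import Mathlib

open MeasureTheory Metric Set

noncomputable section

/-- The Laplacian of a function on Euclidean space. -/
def lapl {N : ℕ} (f : EuclideanSpace ℝ (Fin N) → ℝ) (x : EuclideanSpace ℝ (Fin N)) : ℝ :=
  ∑ i : Fin N,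
    fderiv ℝ (fun y => fderiv ℝ f y (EuclideanSpace.single i (1 : ℝ))) x
      (EuclideanSpace.single i (1 : ℝ))

/-- `(α, ψ)` is a solution of problem `(P)_λ` on `Ω`:
`ψ ∈ C²`, `-Δψ = (max (α + λψ) 0)^p` in `Ω`, `ψ = 0` on `∂Ω`, and
`∫_Ω (max (α + λψ) 0)^p = 1`. -/
def IsSol {N : ℕ} (Ω : Set (EuclideanSpace ℝ (Fin N))) (p lam α : ℝ)
    (ψ : EuclideanSpace ℝ (Fin N) → ℝ) : Prop :=
  ContDiff ℝ 2 ψ ∧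
  (∀ x ∈ Ω, -lapl ψ x = (max (α + lam * ψ x) 0) ^ p) ∧
  (∀ x ∈ frontier Ω, ψ x = 0) ∧
  (∫ x in Ω, (max (α + lam * ψ x) 0) ^ p) = 1

/-- `Ω` is a bounded domain of class `C³`: open, connected, bounded, and near every
boundary point `Ω` is the sublevel set of a `C³` function with nonvanishing gradient. -/
def IsC3Domain {N : ℕ} (Ω : Set (EuclideanSpace ℝ (Fin N))) : Prop :=
  IsOpen Ω ∧ IsConnected Ω ∧ Bornology.IsBounded Ω ∧
  ∀ x ∈ frontier Ω, ∃ (U : Set (EuclideanSpace ℝ (Fin N)))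
      (f : EuclideanSpace ℝ (Fin N) → ℝ),
    IsOpen U ∧ x ∈ U ∧ ContDiff ℝ 3 f ∧ (∀ y ∈ U, fderiv ℝ f y ≠ 0) ∧
    Ω ∩ U = {y ∈ U | f y < 0}

/-- `Λ(Ω, t)`: the infimum of `(∫_Ω ‖∇w‖²) / (∫_Ω |w|^t)^(2/t)` over nonzero smooth
compactly supported `w` with support contained in `Ω`. -/
def Lam {N : ℕ} (Ω : Set (EuclideanSpace ℝ (Fin N))) (t : ℝ) : ℝ :=
  sInf {r : ℝ | ∃ w : EuclideanSpace ℝ (Fin N) → ℝ, ContDiff ℝ (⊤ : ℕ∞) w ∧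
    HasCompactSupport w ∧ tsupport w ⊆ Ω ∧ w ≠ 0 ∧
    r = (∫ x in Ω, ‖gradient w x‖ ^ 2) / (∫ x in Ω, |w x| ^ t) ^ (2 / t)}

open Filter Topology

theorem norm_normed_convolution_le {E F : Type*} [NormedAddCommGroup E] [InnerProductSpace ℝ E]
    [FiniteDimensional ℝ E] [MeasurableSpace E] [BorelSpace E] [NormedAddCommGroup F]
    [NormedSpace ℝ F] [CompleteSpace F] (φ : ContDiffBump (0 : E)) {C : ℝ} (hC : 0 ≤ C)
    {g : E → F} (hg : Continuous g) (hgC : ∀ x, ‖g x‖ ≤ C) (x : E) :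
    ‖MeasureTheory.convolution (φ.normed volume) g (ContinuousLinearMap.lsmul ℝ ℝ) volume x‖
      ≤ C := by
  simpa using dist_convolution_le (z₀ := (0 : F)) (x₀ := x) (R := φ.rOut) hC
    φ.support_normed_eq.subset φ.nonneg_normed φ.integral_normed
    hg.aestronglyMeasurable (fun y _ => by simpa using hgC y)

/-- A `C¹` function with compact support in an open set is a pointwise limit, together with its
derivative, of uniformly bounded smooth functions with compact support in that set. -/
theorem exists_smooth_approx {E : Type*} [NormedAddCommGroup E] [InnerProductSpace ℝ E]
    [FiniteDimensional ℝ E] [MeasurableSpace E] [BorelSpace E] {Ω : Set E} (hΩ : IsOpen Ω)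
    {v : E → ℝ} (hv : ContDiff ℝ 1 v) (hc : HasCompactSupport v) (hs : tsupport v ⊆ Ω) :
    ∃ (w : ℕ → E → ℝ) (C : ℝ), (∀ n, ContDiff ℝ (⊤ : ℕ∞) (w n)) ∧
      (∀ n, HasCompactSupport (w n)) ∧ (∀ n, tsupport (w n) ⊆ Ω) ∧
      (∀ n x, ‖w n x‖ ≤ C) ∧ (∀ n x, ‖fderiv ℝ (w n) x‖ ≤ C) ∧
      (∀ x, Tendsto (fun n => w n x) atTop (𝓝 (v x))) ∧
      (∀ x, Tendsto (fun n => fderiv ℝ (w n) x) atTop (𝓝 (fderiv ℝ v x))) := by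
  obtain ⟨d, hd0, hd⟩ := hc.isCompact.exists_cthickening_subset_open hΩ hs
  have hcd : Continuous (fderiv ℝ v) := hv.continuous_fderiv one_ne_zero
  obtain ⟨C₁, hC₁⟩ := hc.exists_bound_of_continuous hv.continuous
  obtain ⟨C₂, hC₂⟩ := (hc.fderiv ℝ).exists_bound_of_continuous hcd
  have hC0 : 0 ≤ max C₁ C₂ := ((norm_nonneg _).trans (hC₁ 0)).trans (le_max_left _ _)
  let φ : ℕ → ContDiffBump (0 : E) := fun n =>
    ⟨d / (n + 1) / 2, d / (n + 1), by positivity, half_lt_self (by positivity)⟩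
  have hφ : Tendsto (fun n => (φ n).rOut) atTop (𝓝 0) := by
    simpa [φ, div_eq_mul_one_div d] using tendsto_one_div_add_atTop_nhds_zero_nat.const_mul d
  have hφd : ∀ n, (φ n).rOut ≤ d := fun n => div_le_self hd0.le (by simp)
  have hder (n : ℕ) (x : E) : fderiv ℝ (MeasureTheory.convolution ((φ n).normed volume) v
        (ContinuousLinearMap.lsmul ℝ ℝ) volume) x =
      MeasureTheory.convolution ((φ n).normed volume) (fderiv ℝ v)
        (ContinuousLinearMap.lsmul ℝ ℝ) volume x :=
    (hc.hasFDerivAt_convolution_right (ContinuousLinearMap.lsmul ℝ ℝ)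
      (φ n).continuous_normed.locallyIntegrable hv x).fderiv
  refine ⟨fun n => MeasureTheory.convolution ((φ n).normed volume) v
    (ContinuousLinearMap.lsmul ℝ ℝ) volume, max C₁ C₂, fun n => ?_, fun n => ?_, fun n => ?_,
    fun n => norm_normed_convolution_le _ hC0 hv.continuous fun x =>
      (hC₁ x).trans (le_max_left _ _),
    fun n x => ?_,
    ContDiffBump.convolution_tendsto_right_of_continuous hφ hv.continuous, fun x => ?_⟩
  · exact (φ n).hasCompactSupport_normed.contDiff_convolution_left _ (φ n).contDiff_normed
      hv.continuous.locallyIntegrable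
  · exact (φ n).hasCompactSupport_normed.convolution _ hc
  · refine (closure_minimal ?_ isClosed_cthickening).trans hd
    refine (support_convolution_subset _).trans ?_
    rintro _ ⟨a, ha, b, hb, rfl⟩
    rw [(φ n).support_normed_eq, mem_ball_zero_iff] at ha
    refine mem_cthickening_of_dist_le _ b _ _ (subset_closure hb) ?_
    simpa using ha.le.trans (hφd n)
  · rw [hder]
    exact norm_normed_convolution_le _ hC0 hcd (fun x => (hC₂ x).trans (le_max_right _ _)) x
  · simp_rw [hder]
    exact ContDiffBump.convolution_tendsto_right_of_continuous hφ hcd x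

theorem norm_gradient_eq_norm_fderiv {F : Type*} [NormedAddCommGroup F] [InnerProductSpace ℝ F]
    [CompleteSpace F] (f : F → ℝ) (x : F) : ‖gradient f x‖ = ‖fderiv ℝ f x‖ := by
  simp [gradient]

theorem norm_sq_eq_sum_sq_apply_single {N : ℕ} (L : EuclideanSpace ℝ (Fin N) →L[ℝ] ℝ) :
    ‖L‖ ^ 2 = ∑ i, L (EuclideanSpace.single i 1) ^ 2 := by
  rw [← (InnerProductSpace.toDual ℝ _).symm.norm_map L, EuclideanSpace.real_norm_sq_eq]
  congr! 2 with i
  rw [← InnerProductSpace.toDual_symm_apply (𝕜 := ℝ) (y := L), real_inner_comm,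
    EuclideanSpace.inner_single_left]
  simp

theorem Lam_mul_le_of_smooth {N : ℕ} {Ω : Set (EuclideanSpace ℝ (Fin N))} {t : ℝ} (ht : 0 < t)
    {w : EuclideanSpace ℝ (Fin N) → ℝ} (hw : ContDiff ℝ (⊤ : ℕ∞) w) (hc : HasCompactSupport w)
    (hs : tsupport w ⊆ Ω) :
    Lam Ω t * (∫ x in Ω, |w x| ^ t) ^ (2 / t) ≤ ∫ x in Ω, ‖fderiv ℝ w x‖ ^ 2 := by
  have hnum : 0 ≤ ∫ x in Ω, ‖fderiv ℝ w x‖ ^ 2 := integral_nonneg fun x => by positivity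
  have hden : 0 ≤ (∫ x in Ω, |w x| ^ t) ^ (2 / t) :=
    Real.rpow_nonneg (integral_nonneg fun x => by positivity) _
  rcases hden.eq_or_lt with h0 | h0
  · simpa [← h0] using hnum
  rw [← le_div_iff₀ h0]
  refine csInf_le ⟨0, ?_⟩ ⟨w, hw, hc, hs, ?_, by simp_rw [norm_gradient_eq_norm_fderiv]⟩
  · rintro _ ⟨f, -, -, -, -, rfl⟩
    exact div_nonneg (integral_nonneg fun x => by positivity)
      (Real.rpow_nonneg (integral_nonneg fun x => by positivity) _)
  · rintro rfl
    simp [ht.ne', Real.zero_rpow (div_pos two_pos ht).ne'] at h0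

theorem Lam_mul_le {N : ℕ} {Ω : Set (EuclideanSpace ℝ (Fin N))} (hΩ : IsOpen Ω)
    (hvol : volume Ω ≠ ⊤) {t : ℝ} (ht : 0 < t)
    {v : EuclideanSpace ℝ (Fin N) → ℝ} (hv : ContDiff ℝ 1 v) (hc : HasCompactSupport v)
    (hs : tsupport v ⊆ Ω) :
    Lam Ω t * (∫ x in Ω, |v x| ^ t) ^ (2 / t) ≤ ∫ x in Ω, ‖fderiv ℝ v x‖ ^ 2 := by
  obtain ⟨w, C, hw, hwc, hws, hC, hC', hlim, hlim'⟩ := exists_smooth_approx hΩ hv hc hs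
  have hfin : IsFiniteMeasure (volume.restrict Ω) := ⟨by simpa using hvol.lt_top⟩
  have h₁ : Tendsto (fun n => ∫ x in Ω, |w n x| ^ t) atTop (𝓝 (∫ x in Ω, |v x| ^ t)) := by
    refine tendsto_integral_of_dominated_convergence (fun _ => C ^ t) (fun n => ?_)
      (integrable_const _) (fun n => ae_of_all _ fun x => ?_) (ae_of_all _ fun x => ?_)
    · exact ((hw n).continuous.abs.rpow_const fun _ => Or.inr ht.le).aestronglyMeasurable
    · rw [Real.norm_of_nonneg (by positivity)]
      exact Real.rpow_le_rpow (abs_nonneg _) (hC n x) ht.le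
    · exact (hlim x).abs.rpow_const (Or.inr ht.le)
  have h₂ : Tendsto (fun n => ∫ x in Ω, ‖fderiv ℝ (w n) x‖ ^ 2) atTop
      (𝓝 (∫ x in Ω, ‖fderiv ℝ v x‖ ^ 2)) := by
    refine tendsto_integral_of_dominated_convergence (fun _ => C ^ 2) (fun n => ?_)
      (integrable_const _) (fun n => ae_of_all _ fun x => ?_) (ae_of_all _ fun x => ?_)
    · exact (((hw n).continuous_fderiv (by simp)).norm.pow 2).aestronglyMeasurable
    · rw [Real.norm_of_nonneg (by positivity)]
      exact pow_le_pow_left₀ (norm_nonneg _) (hC' n x) 2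
    · exact (hlim' x).norm.pow 2
  exact le_of_tendsto_of_tendsto' ((h₁.rpow_const (Or.inr (by positivity))).const_mul _) h₂
    fun n => Lam_mul_le_of_smooth ht (hw n) (hwc n) (hws n)

/-- The Sobolev inequality makes `Λ(Ω, 2p)` positive in the subcritical range. -/
theorem Lam_two_mul_pos {N : ℕ} (hN : 2 ≤ N) {Ω : Set (EuclideanSpace ℝ (Fin N))}
    (hΩ : IsOpen Ω) (hb : Bornology.IsBounded Ω) (hvol : volume Ω = 1) {p : ℝ} (hp1 : 1 < p)
    (hpN : N = 2 ∨ p < (N : ℝ) / ((N : ℝ) - 2)) : 0 < Lam Ω (2 * p) := by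
  have hp0 : 0 < p := zero_lt_one.trans hp1
  obtain ⟨r, hr1, hr2, hrN, hrp⟩ : ∃ r : NNReal, 1 ≤ r ∧ r ≤ 2 ∧ r < (N : NNReal) ∧
      (r : ℝ)⁻¹ - (N : ℝ)⁻¹ ≤ (2 * p)⁻¹ := by
    rcases hN.eq_or_lt with rfl | h3
    · have hr : 2 * p / (p + 1) < 2 := by
        rw [div_lt_iff₀ (by positivity)]; linarith
      have hr' : ((2 * p / (p + 1)).toNNReal : ℝ) = 2 * p / (p + 1) :=
        Real.coe_toNNReal _ (by positivity)
      refine ⟨(2 * p / (p + 1)).toNNReal, ?_, ?_, ?_, ?_⟩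
      · rw [← NNReal.coe_le_coe, hr', NNReal.coe_one, le_div_iff₀ (by positivity)]
        linarith
      · rw [← NNReal.coe_le_coe, hr']
        exact hr.le
      · rw [← NNReal.coe_lt_coe, hr']
        exact hr
      · rw [hr']
        apply le_of_eq
        push_cast
        field_simp
        ring
    · have h3' : (3 : ℝ) ≤ N := by exact_mod_cast h3
      refine ⟨2, by norm_num, le_rfl, by exact_mod_cast h3, ?_⟩
      have hp := hpN.resolve_left h3.ne'
      rw [lt_div_iff₀ (by linarith)] at hp
      have h : (2 : ℝ)⁻¹ - (N : ℝ)⁻¹ = (N - 2) / (2 * N) := by field_simp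
      rw [NNReal.coe_ofNat, h, div_le_iff₀ (by positivity), ← div_eq_inv_mul,
        le_div_iff₀ (by positivity)]
      nlinarith
  have hprob : IsProbabilityMeasure (volume.restrict Ω) := ⟨by simpa using hvol⟩
  set K : NNReal := eLpNormLESNormFDerivOfLeConst ℝ
    (volume : Measure (EuclideanSpace ℝ (Fin N))) Ω r (2 * p).toNNReal with hK
  have hsob {w : EuclideanSpace ℝ (Fin N) → ℝ} (hw : ContDiff ℝ (⊤ : ℕ∞) w)
      (hc : HasCompactSupport w) (hs : tsupport w ⊆ Ω) :
      (∫ x in Ω, |w x| ^ (2 * p)) ^ (2 / (2 * p)) ≤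
        (K + 1 : ℝ) ^ 2 * ∫ x in Ω, ‖fderiv ℝ w x‖ ^ 2 := by
    have hq : ((2 * p).toNNReal : ℝ) = 2 * p := Real.coe_toNNReal _ (by positivity)
    have hq0 : (2 * p).toNNReal ≠ 0 := by simpa using hp0
    have hX : 0 ≤ ∫ x in Ω, |w x| ^ (2 * p) := integral_nonneg fun x => by positivity
    have hY : 0 ≤ ∫ x in Ω, ‖fderiv ℝ w x‖ ^ 2 := integral_nonneg fun x => by positivity
    have hcd : Continuous (fderiv ℝ w) := hw.continuous_fderiv (by simp)
    have hm₁ : MemLp w ((2 * p).toNNReal : ENNReal) (volume.restrict Ω) :=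
      hw.continuous.memLp_of_hasCompactSupport hc
    have hm₂ : MemLp (fderiv ℝ w) 2 (volume.restrict Ω) :=
      hcd.memLp_of_hasCompactSupport (hc.fderiv ℝ)
    have h := eLpNorm_le_eLpNorm_fderiv_of_le (μ := volume) (hw.of_le (by simp))
      ((subset_tsupport w).trans hs) hr1 (by simpa using hrN)
      (q := (2 * p).toNNReal) (by simpa [hq] using hrp) hb
    rw [← eLpNorm_restrict_eq_of_support_subset ((subset_tsupport w).trans hs),
      ← eLpNorm_restrict_eq_of_support_subset (f := fderiv ℝ w)
        ((support_fderiv_subset ℝ).trans hs), ← hK] at h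
    replace h := h.trans (mul_le_mul_right (eLpNorm_le_eLpNorm_of_exponent_le
      (show (r : ENNReal) ≤ 2 by exact_mod_cast hr2) hcd.aestronglyMeasurable) _)
    rw [hm₁.eLpNorm_eq_integral_rpow_norm (by exact_mod_cast hq0) ENNReal.coe_ne_top,
      hm₂.eLpNorm_eq_integral_rpow_norm two_ne_zero ENNReal.ofNat_ne_top,
      ← ENNReal.ofReal_coe_nnreal (p := K), ← ENNReal.ofReal_mul K.coe_nonneg,
      ENNReal.ofReal_le_ofReal_iff (by positivity)] at h
    simp only [ENNReal.coe_toReal, hq, ENNReal.toReal_ofNat, Real.rpow_two, Real.norm_eq_abs] at h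
    have h2 := pow_le_pow_left₀ (by positivity) h 2
    rw [mul_pow, ← Real.rpow_mul_natCast hX, ← Real.rpow_mul_natCast hY,
      show (2 * p)⁻¹ * ((2 : ℕ) : ℝ) = 2 / (2 * p) by push_cast; field_simp,
      show (2 : ℝ)⁻¹ * ((2 : ℕ) : ℝ) = 1 by norm_num, Real.rpow_one] at h2
    refine h2.trans ?_
    gcongr
    linarith
  have hne : Ω.Nonempty := nonempty_of_measure_ne_zero (μ := volume) (by simp [hvol])
  refine lt_of_lt_of_le (b := ((K + 1 : ℝ) ^ 2)⁻¹) (by positivity) (le_csInf ?_ ?_)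
  · obtain ⟨x, hx⟩ := hne
    obtain ⟨f, hf, hfc, hfs, -, hfx⟩ := exists_contDiff_tsupport_subset (n := (⊤ : ℕ∞))
      (hΩ.mem_nhds hx)
    exact ⟨_, f, hfs, hfc, hf, fun h => by simp [h] at hfx, rfl⟩
  · rintro _ ⟨w, hw, hc, hs, hw0, rfl⟩
    simp_rw [norm_gradient_eq_norm_fderiv]
    have hpos : 0 < ∫ x in Ω, |w x| ^ (2 * p) := by
      obtain ⟨x, hx⟩ := Function.ne_iff.mp hw0
      have h2p : 0 < 2 * p := by positivity
      rw [setIntegral_eq_integral_of_forall_compl_eq_zero fun y hy => by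
        rw [image_eq_zero_of_notMem_tsupport fun h => hy (hs h), abs_zero, Real.zero_rpow h2p.ne']]
      refine (hw.continuous.abs.rpow_const fun _ => Or.inr h2p.le
        ).integral_pos_of_hasCompactSupport_nonneg_nonzero (x := x) ?_ (fun y => ?_) ?_
      · exact hc.comp_left (g := fun y => |y| ^ (2 * p)) (by simp [hp0.ne'])
      · exact Real.rpow_nonneg (abs_nonneg _) _
      · exact (Real.rpow_pos_of_pos (abs_pos.mpr hx) _).ne'
    rw [le_div_iff₀ (Real.rpow_pos_of_pos hpos _), inv_mul_le_iff₀ (by positivity)]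
    exact hsob hw hc hs

/-- A smooth approximation of the positive part that vanishes on `(-∞, ε]`. -/
theorem exists_smooth_truncation {ε : ℝ} (hε : 0 < ε) :
    ∃ φ : ℝ → ℝ, ContDiff ℝ (⊤ : ℕ∞) φ ∧ (∀ s ≤ ε, φ s = 0) ∧ (∀ s, 0 ≤ deriv φ s) ∧
      (∀ s, deriv φ s ≤ 1) ∧ (∀ s, 0 ≤ φ s) ∧ (∀ s, φ s ≤ max s 0) ∧
      (∀ s, max s 0 - 2 * ε ≤ φ s) := by
  let g : ℝ → ℝ := fun x => Real.smoothTransition (x / ε - 1)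
  have hg : ContDiff ℝ (⊤ : ℕ∞) g :=
    Real.smoothTransition.contDiff.comp ((contDiff_id.div_const ε).sub contDiff_const)
  let φ : ℝ → ℝ := fun s => ∫ x in (0 : ℝ)..s, g x
  have hd : ∀ s, HasDerivAt φ (g s) s := fun s =>
    hg.continuous.integral_hasStrictDerivAt 0 s |>.hasDerivAt
  have hderiv : deriv φ = g := funext fun s => (hd s).deriv
  have hdiff : Differentiable ℝ φ := fun s => (hd s).differentiableAt
  have h0 : ∀ s ≤ ε, φ s = 0 := fun s hs => by
    have : ∫ x in (0 : ℝ)..s, g x = ∫ x in (0 : ℝ)..s, (0 : ℝ) := by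
      refine intervalIntegral.integral_congr fun x hx => ?_
      refine Real.smoothTransition.zero_of_nonpos ?_
      have : x ≤ ε := hx.2.trans (max_le hε.le hs)
      rw [sub_nonpos, div_le_one hε]
      exact this
    simpa using this
  have hnn : ∀ s, 0 ≤ deriv φ s := fun s => by
    rw [hderiv]; exact Real.smoothTransition.nonneg _
  have hle : ∀ s, deriv φ s ≤ 1 := fun s => by
    rw [hderiv]; exact Real.smoothTransition.le_one _
  have hmono : Monotone φ := monotone_of_deriv_nonneg hdiff hnn
  have hpos : ∀ s, 0 ≤ φ s := fun s => by
    rw [← h0 (min s ε) (min_le_right _ _)]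
    exact hmono (min_le_left _ _)
  refine ⟨φ, contDiff_infty_iff_deriv.mpr ⟨hdiff, hderiv ▸ hg⟩, h0, hnn, hle, hpos, fun s => ?_,
    fun s => ?_⟩
  · rcases le_total s 0 with hs | hs
    · rw [h0 s (hs.trans hε.le)]
      exact le_max_right _ _
    · have := image_sub_le_mul_sub_of_deriv_le hdiff hle hs
      rw [h0 0 hε.le] at this
      exact le_max_of_le_left (by linarith)
  · rcases le_total s (2 * ε) with hs | hs
    · have : max s 0 ≤ 2 * ε := max_le hs (by positivity)
      linarith [hpos s]
    · rw [max_eq_left (le_trans (by positivity) hs)]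
      have := (convex_Ici (2 * ε)).mul_sub_le_image_sub_of_le_deriv (C := 1)
        hdiff.continuous.continuousOn hdiff.differentiableOn (fun x hx => ?_) (2 * ε)
        (mem_Ici.mpr le_rfl) s hs hs
      · linarith [hpos (2 * ε)]
      · rw [interior_Ici, mem_Ioi] at hx
        rw [hderiv]
        refine (Real.smoothTransition.one_of_one_le ?_).ge
        rw [le_sub_iff_add_le, le_div_iff₀ hε]
        linarith

/-- Truncating above a positive level a function that is nonpositive on the boundary of a bounded
open set gives a function with compact support in that set. -/
theorem indicator_comp_contDiff {E : Type*} [NormedAddCommGroup E] [NormedSpace ℝ E]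
    [ProperSpace E] {Ω : Set E} (hΩ : IsOpen Ω) (hb : Bornology.IsBounded Ω) {u : E → ℝ}
    {n : WithTop ℕ∞} (hu : ContDiff ℝ n u) (hu0 : ∀ x ∈ frontier Ω, u x ≤ 0) {φ : ℝ → ℝ}
    (hφ : ContDiff ℝ n φ) {ε : ℝ} (hε : 0 < ε) (hφ0 : ∀ s ≤ ε, φ s = 0) :
    ContDiff ℝ n (Ω.indicator (φ ∘ u)) ∧ HasCompactSupport (Ω.indicator (φ ∘ u)) ∧
      tsupport (Ω.indicator (φ ∘ u)) ⊆ Ω := by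
  have hK : IsClosed (closure Ω ∩ {x | ε ≤ u x}) :=
    isClosed_closure.inter (isClosed_le continuous_const hu.continuous)
  have hsupp : Function.support (Ω.indicator (φ ∘ u)) ⊆ closure Ω ∩ {x | ε ≤ u x} := by
    intro x hx
    rw [support_indicator] at hx
    exact ⟨subset_closure hx.1, le_of_not_ge fun h => hx.2 (hφ0 _ h)⟩
  have hKΩ : closure Ω ∩ {x | ε ≤ u x} ⊆ Ω := by
    rintro x ⟨hx, hxu⟩
    by_contra hxΩ
    exact (hε.trans_le hxu).not_ge
      (hu0 x (by rw [hΩ.frontier_eq]; exact ⟨hx, hxΩ⟩))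
  have hts := closure_minimal hsupp hK
  refine ⟨contDiff_iff_contDiffAt.mpr fun x => ?_, ?_, hts.trans hKΩ⟩
  · by_cases hx : x ∈ Ω
    · refine (hφ.comp hu).contDiffAt.congr_of_eventuallyEq ?_
      filter_upwards [hΩ.mem_nhds hx] with y hy
      exact indicator_of_mem hy _
    · exact (contDiffAt_const (c := (0 : ℝ))).congr_of_eventuallyEq
        (notMem_tsupport_iff_eventuallyEq.mp fun h => hx (hKΩ (hts h)))
  · exact hb.isCompact_closure.of_isClosed_subset (isClosed_tsupport _)
      (hts.trans inter_subset_left)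

theorem integral_fderiv_mul_fderiv_eq_neg {E : Type*} [NormedAddCommGroup E] [NormedSpace ℝ E]
    [FiniteDimensional ℝ E] [MeasurableSpace E] [BorelSpace E] {μ : Measure E}
    [μ.IsAddHaarMeasure] {u v : E → ℝ} (hu : ContDiff ℝ 2 u) (hv : ContDiff ℝ 1 v)
    (hc : HasCompactSupport v) (e : E) :
    Integrable (fun x => fderiv ℝ v x e * fderiv ℝ u x e) μ ∧
      Integrable (fun x => v x * fderiv ℝ (fun y => fderiv ℝ u y e) x e) μ ∧
      ∫ x, fderiv ℝ v x e * fderiv ℝ u x e ∂μ =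
        -∫ x, v x * fderiv ℝ (fun y => fderiv ℝ u y e) x e ∂μ := by
  have hd : ContDiff ℝ 1 fun y => fderiv ℝ u y e :=
    (hu.fderiv_right (m := 1) (by norm_num)).clm_apply contDiff_const
  have hdd : Continuous fun x => fderiv ℝ (fun y => fderiv ℝ u y e) x e :=
    (hd.continuous_fderiv one_ne_zero).clm_apply continuous_const
  have hvd : Continuous fun x => fderiv ℝ v x e :=
    (hv.continuous_fderiv one_ne_zero).clm_apply continuous_const
  have hvc : HasCompactSupport fun x => fderiv ℝ v x e := hc.fderiv_apply ℝ e
  have hint : Integrable (fun x => fderiv ℝ v x e * fderiv ℝ u x e) μ :=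
    (hvd.mul hd.continuous).integrable_of_hasCompactSupport hvc.mul_right
  have hint' : Integrable (fun x => v x * fderiv ℝ (fun y => fderiv ℝ u y e) x e) μ :=
    (hv.continuous.mul hdd).integrable_of_hasCompactSupport hc.mul_right
  refine ⟨hint, hint', ?_⟩
  rw [integral_mul_fderiv_eq_neg_fderiv_mul_of_integrable hint hint'
    ((hv.continuous.mul hd.continuous).integrable_of_hasCompactSupport hc.mul_right)
    (fun x _ => hv.differentiable one_ne_zero x) (fun x _ => hd.differentiable one_ne_zero x),
    neg_neg]

theorem norm_fderiv_comp_sq_le {N : ℕ} {u : EuclideanSpace ℝ (Fin N) → ℝ} {φ : ℝ → ℝ}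
    {x : EuclideanSpace ℝ (Fin N)} (hu : DifferentiableAt ℝ u x)
    (hφ : DifferentiableAt ℝ φ (u x)) (hφ0 : 0 ≤ deriv φ (u x)) (hφ1 : deriv φ (u x) ≤ 1) :
    ‖fderiv ℝ (φ ∘ u) x‖ ^ 2 ≤ ∑ i, fderiv ℝ (φ ∘ u) x (EuclideanSpace.single i 1) *
      fderiv ℝ u x (EuclideanSpace.single i 1) := by
  rw [(hφ.hasDerivAt.comp_hasFDerivAt x hu.hasFDerivAt).fderiv, norm_sq_eq_sum_sq_apply_single]
  refine Finset.sum_le_sum fun i _ => ?_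
  rw [_root_.smul_apply, smul_eq_mul]
  nlinarith [mul_nonneg (mul_nonneg hφ0 (sub_nonneg.mpr hφ1))
    (sq_nonneg (fderiv ℝ u x (EuclideanSpace.single i 1)))]

/-- Green's formula for a truncation `v = φ ∘ u` where the derivative of `φ` lies in
`[0, 1]`. -/
theorem integral_norm_fderiv_sq_le {N : ℕ} {Ω : Set (EuclideanSpace ℝ (Fin N))} (hΩ : IsOpen Ω)
    {u v : EuclideanSpace ℝ (Fin N) → ℝ} (hu : ContDiff ℝ 2 u) {φ : ℝ → ℝ}
    (hφ : Differentiable ℝ φ) (hφ0 : ∀ s, 0 ≤ deriv φ s) (hφ1 : ∀ s, deriv φ s ≤ 1)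
    (hv : ContDiff ℝ 1 v) (hc : HasCompactSupport v) (hs : tsupport v ⊆ Ω)
    (hvu : ∀ x ∈ Ω, v x = φ (u x)) :
    ∫ x in Ω, ‖fderiv ℝ v x‖ ^ 2 ≤ ∫ x in Ω, v x * -lapl u x := by
  have hparts (i : Fin N) := integral_fderiv_mul_fderiv_eq_neg (μ := volume) hu hv hc
    (EuclideanSpace.single i (1 : ℝ))
  have hv0 : ∀ x ∉ Ω, fderiv ℝ v x = 0 := fun x hx =>
    image_eq_zero_of_notMem_tsupport fun h => hx (hs (tsupport_fderiv_subset ℝ h))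
  have hsum : Integrable fun x => ∑ i : Fin N, fderiv ℝ v x (EuclideanSpace.single i (1 : ℝ)) *
      fderiv ℝ u x (EuclideanSpace.single i (1 : ℝ)) :=
    integrable_finsetSum _ fun i _ => (hparts i).1
  have hcn : Continuous fun x => ‖fderiv ℝ v x‖ := (hv.continuous_fderiv one_ne_zero).norm
  have hsq : Integrable fun x => ‖fderiv ℝ v x‖ ^ 2 := by
    simp only [sq]
    exact (hcn.mul hcn).integrable_of_hasCompactSupport (hc.fderiv ℝ).norm.mul_right
  have hpt : ∀ x ∈ Ω, ‖fderiv ℝ v x‖ ^ 2 ≤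
      ∑ i : Fin N, fderiv ℝ v x (EuclideanSpace.single i (1 : ℝ)) *
        fderiv ℝ u x (EuclideanSpace.single i (1 : ℝ)) := by
    intro x hx
    have hvφ : v =ᶠ[𝓝 x] φ ∘ u := by
      filter_upwards [hΩ.mem_nhds hx] with y hy using hvu y hy
    rw [hvφ.fderiv_eq]
    exact norm_fderiv_comp_sq_le (hu.differentiable two_ne_zero x) (hφ _) (hφ0 _) (hφ1 _)
  refine (setIntegral_mono_on hsq.integrableOn hsum.integrableOn hΩ.measurableSet hpt).trans_eq ?_
  rw [setIntegral_eq_integral_of_forall_compl_eq_zero fun x hx => by simp [hv0 x hx],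
    setIntegral_eq_integral_of_forall_compl_eq_zero fun x hx => by
      rw [image_eq_zero_of_notMem_tsupport fun h => hx (hs h), zero_mul],
    integral_finsetSum _ fun i _ => (hparts i).1, Finset.sum_congr rfl fun i _ => (hparts i).2.2,
    Finset.sum_neg_distrib, ← integral_finsetSum _ fun i _ => (hparts i).2.1, ← integral_neg]
  simp only [lapl, Finset.mul_sum, mul_neg]

theorem lapl_const_add_const_mul {N : ℕ} {ψ : EuclideanSpace ℝ (Fin N) → ℝ}
    (hψ : ContDiff ℝ 2 ψ) (a c : ℝ) (x : EuclideanSpace ℝ (Fin N)) :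
    lapl (fun y => a + c * ψ y) x = c * lapl ψ x := by
  have h (y : EuclideanSpace ℝ (Fin N)) :
      fderiv ℝ (fun y => a + c * ψ y) y = c • fderiv ℝ ψ y := by
    rw [fderiv_const_add, fderiv_const_mul (hψ.differentiable two_ne_zero y)]
  simp only [lapl, h, _root_.smul_apply, smul_eq_mul, Finset.mul_sum]
  refine Finset.sum_congr rfl fun i _ => ?_
  rw [fderiv_const_mul, _root_.smul_apply, smul_eq_mul]
  exact ((hψ.fderiv_right (m := 1) (by norm_num)).clm_apply contDiff_const).differentiable
    one_ne_zero x

/-- A solution with nonpositive boundary value forces `Λ(Ω, 2p) ≤ λ`. -/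
theorem Lam_le_of_isSol_of_nonpos {N : ℕ} {Ω : Set (EuclideanSpace ℝ (Fin N))} (hΩ : IsOpen Ω)
    (hb : Bornology.IsBounded Ω) {p lam α : ℝ} (hp : 1 < p) (hlam : 0 ≤ lam) (hα : α ≤ 0)
    {ψ : EuclideanSpace ℝ (Fin N) → ℝ} (hsol : IsSol Ω p lam α ψ) : Lam Ω (2 * p) ≤ lam := by
  obtain ⟨hψ, heq, hbd, hmass⟩ := hsol
  have hp0 : 0 < p := zero_lt_one.trans hp
  have hfin : IsFiniteMeasure (volume.restrict Ω) := ⟨by simpa using hb.measure_lt_top⟩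
  set u : EuclideanSpace ℝ (Fin N) → ℝ := fun x => α + lam * ψ x with hu_def
  have hu : ContDiff ℝ 2 u := contDiff_const.add (contDiff_const.mul hψ)
  have hu0 : ∀ x ∈ frontier Ω, u x ≤ 0 := fun x hx => by simpa [u, hbd x hx] using hα
  set U : EuclideanSpace ℝ (Fin N) → ℝ := fun x => max (u x) 0 with hU_def
  have hU : Continuous U := hu.continuous.max continuous_const
  have hUnn : ∀ x, 0 ≤ U x := fun x => le_max_right _ _
  have hbdd {f : EuclideanSpace ℝ (Fin N) → ℝ} (hf : Continuous f) :
      IntegrableOn f Ω := (hf.continuousOn.integrableOn_compact hb.isCompact_closure).mono_set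
        subset_closure
  have hmem {f : EuclideanSpace ℝ (Fin N) → ℝ} (hf : Continuous f) (q : ENNReal) :
      MemLp f q (volume.restrict Ω) := by
    obtain ⟨M, hM⟩ := hb.isCompact_closure.exists_bound_of_continuousOn hf.continuousOn
    refine MemLp.of_bound hf.aestronglyMeasurable M ?_
    filter_upwards [self_mem_ae_restrict hΩ.measurableSet] with x hx using hM x (subset_closure hx)
  have hpow {q : ℝ} (hq : 0 < q) : Continuous fun x => U x ^ q :=
    hU.rpow_const fun _ => Or.inr hq.le
  set I : ℝ := ∫ x in Ω, U x ^ (2 * p) with hI_def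
  have hmass' : ∫ x in Ω, U x ^ p = 1 := hmass
  have hIpos : 0 < I := by
    have hsupp {q : ℝ} (hq : 0 < q) : Function.support (fun x => U x ^ q) = Function.support U := by
      ext x
      simp [Real.rpow_eq_zero (hUnn x) hq.ne']
    have h1 : 0 < ∫ x in Ω, U x ^ p := by rw [hmass']; exact one_pos
    rw [integral_pos_iff_support_of_nonneg (fun x => Real.rpow_nonneg (hUnn x) _)
      (hbdd (hpow hp0)), hsupp hp0] at h1
    rwa [hI_def, integral_pos_iff_support_of_nonneg (fun x => Real.rpow_nonneg (hUnn x) _)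
      (hbdd (hpow (by positivity))), hsupp (by positivity)]
  have hholder : ∫ x in Ω, U x ^ (p - 1) * U x ^ 2 ≤ I ^ (1 / p) := by
    have hconj : (p / (p - 1)).HolderConjugate p := (Real.HolderConjugate.conjExponent hp).symm
    have h := integral_mul_le_Lp_mul_Lq_of_nonneg (μ := volume.restrict Ω) hconj
      (f := fun x => U x ^ (p - 1)) (g := fun x => U x ^ 2)
      (ae_of_all _ fun x => Real.rpow_nonneg (hUnn x) _) (ae_of_all _ fun x => sq_nonneg _)
      (hmem (hpow (sub_pos.mpr hp)) _) (hmem (hU.pow 2) _)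
    have h₁ : ∀ x, (U x ^ (p - 1)) ^ (p / (p - 1)) = U x ^ p := fun x => by
      rw [← Real.rpow_mul (hUnn x), mul_div_cancel₀ _ (sub_pos.mpr hp).ne']
    have h₂ : ∀ x, (U x ^ 2) ^ p = U x ^ (2 * p) := fun x => by
      rw [← Real.rpow_two, ← Real.rpow_mul (hUnn x)]
    simpa only [h₁, h₂, hmass', Real.one_rpow, one_mul] using h
  have happrox (n : ℕ) : ∃ v : EuclideanSpace ℝ (Fin N) → ℝ,
      AEStronglyMeasurable v (volume.restrict Ω) ∧
      (∀ x ∈ Ω, 0 ≤ v x ∧ v x ≤ U x ∧ U x - 2 * (1 / (n + 1 : ℝ)) ≤ v x) ∧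
      Lam Ω (2 * p) * (∫ x in Ω, |v x| ^ (2 * p)) ^ (2 / (2 * p)) ≤ lam * I ^ (1 / p) := by
    obtain ⟨φ, hφ, hφ0, hd0, hd1, hnn, hle, hge⟩ :=
      exists_smooth_truncation (ε := 1 / (n + 1 : ℝ)) (by positivity)
    obtain ⟨hv, hc, hs⟩ := indicator_comp_contDiff hΩ hb hu hu0
      (by exact_mod_cast contDiff_infty.mp hφ 2)
      (by positivity) hφ0
    have hvx : ∀ x ∈ Ω, Ω.indicator (φ ∘ u) x = φ (u x) := fun x hx => indicator_of_mem hx _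
    refine ⟨Ω.indicator (φ ∘ u), hv.continuous.aestronglyMeasurable, fun x hx => ?_, ?_⟩
    · rw [hvx x hx]
      exact ⟨hnn _, hle _, hge _⟩
    · refine (Lam_mul_le hΩ hb.measure_lt_top.ne (by positivity) (hv.of_le one_le_two) hc hs).trans
        ((integral_norm_fderiv_sq_le hΩ hu (hφ.differentiable (by simp)) hd0 hd1
          (hv.of_le one_le_two) hc hs hvx).trans ?_)
      calc ∫ x in Ω, Ω.indicator (φ ∘ u) x * -lapl u x
          ≤ ∫ x in Ω, lam * (U x ^ (p - 1) * U x ^ 2) := by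
            have hx (x) (hx : x ∈ Ω) : -lapl u x = lam * U x ^ p := by
              rw [lapl_const_add_const_mul hψ, ← mul_neg, heq x hx]
            have hUp (x) : U x ^ (p - 1) * U x ^ 2 = U x * U x ^ p := by
              have h := Real.rpow_add_of_nonneg (hUnn x) (sub_pos.mpr hp).le zero_le_one
              rw [sub_add_cancel, Real.rpow_one] at h
              rw [h]
              ring
            refine integral_mono_of_nonneg ?_
              ((hbdd ((hpow (sub_pos.mpr hp)).mul (hU.pow 2))).const_mul lam) ?_
            · filter_upwards [self_mem_ae_restrict hΩ.measurableSet] with x hxΩ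
              rw [Pi.zero_apply, hx x hxΩ, hvx x hxΩ]
              exact mul_nonneg (hnn _) (mul_nonneg hlam (Real.rpow_nonneg (hUnn x) _))
            · filter_upwards [self_mem_ae_restrict hΩ.measurableSet] with x hxΩ
              rw [hx x hxΩ, hvx x hxΩ, hUp, mul_left_comm]
              exact mul_le_mul_of_nonneg_left (mul_le_mul_of_nonneg_right (hle _)
                (Real.rpow_nonneg (hUnn x) _)) hlam
        _ ≤ lam * I ^ (1 / p) := by
            rw [integral_const_mul]
            exact mul_le_mul_of_nonneg_left hholder hlam
  choose v hvm hv hvle using happrox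
  have hlim : Tendsto (fun n => ∫ x in Ω, |v n x| ^ (2 * p)) atTop (𝓝 I) := by
    refine tendsto_integral_of_dominated_convergence (fun x => U x ^ (2 * p)) (fun n => ?_)
      (hbdd (hpow (by positivity))) (fun n => ?_) ?_
    · exact ((hvm n).norm.aemeasurable.pow_const _).aestronglyMeasurable
    · filter_upwards [self_mem_ae_restrict hΩ.measurableSet] with x hx
      have h := hv n x hx
      rw [Real.norm_of_nonneg (by positivity), abs_of_nonneg h.1]
      exact Real.rpow_le_rpow h.1 h.2.1 (by positivity)
    · filter_upwards [self_mem_ae_restrict hΩ.measurableSet] with x hx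
      have h : Tendsto (fun n => |v n x|) atTop (𝓝 (U x)) := by
        have h0 : Tendsto (fun n : ℕ => U x - 2 * (1 / (n + 1 : ℝ))) atTop (𝓝 (U x)) := by
          simpa using (tendsto_one_div_add_atTop_nhds_zero_nat.const_mul (2 : ℝ)).const_sub (U x)
        refine tendsto_of_tendsto_of_tendsto_of_le_of_le h0 tendsto_const_nhds (fun n => ?_)
          fun n => ?_
        · exact (hv n x hx).2.2.trans (le_abs_self _)
        · simpa only [abs_of_nonneg (hv n x hx).1] using (hv n x hx).2.1
      exact h.rpow_const (Or.inr (by positivity))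
  have hfinal : Lam Ω (2 * p) * I ^ (2 / (2 * p)) ≤ lam * I ^ (1 / p) :=
    le_of_tendsto' ((hlim.rpow_const (Or.inl hIpos.ne')).const_mul _) hvle
  rw [show 2 / (2 * p) = 1 / p by field_simp] at hfinal
  exact le_of_mul_le_mul_right hfinal (Real.rpow_pos_of_pos hIpos _)

theorem stmt9 (N : ℕ) (hN : 2 ≤ N) (Ω : Set (EuclideanSpace ℝ (Fin N)))
    (hΩ : IsC3Domain Ω) (hvol : volume Ω = 1) (p : ℝ) (hp1 : 1 < p)
    (hpN : N = 2 ∨ p < (N : ℝ) / ((N : ℝ) - 2)) :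
    (∃ δ : ℝ, Lam Ω (2 * p) / p < δ ∧
      ∀ lam : ℝ, 0 ≤ lam → lam < δ →
        ∀ (α : ℝ) (ψ : EuclideanSpace ℝ (Fin N) → ℝ), IsSol Ω p lam α ψ → 0 < α) ∧
    (∀ lam : ℝ, 0 ≤ lam → lam ≤ Lam Ω (2 * p) / p →
      ∀ (α : ℝ) (ψ : EuclideanSpace ℝ (Fin N) → ℝ), IsSol Ω p lam α ψ → 0 < α) := by
  have hpos := Lam_two_mul_pos hN hΩ.1 hΩ.2.2.1 hvol hp1 hpN
  have hlt : Lam Ω (2 * p) / p < Lam Ω (2 * p) := div_lt_self hpos hp1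
  have hmain : ∀ lam : ℝ, 0 ≤ lam → lam < Lam Ω (2 * p) →
      ∀ (α : ℝ) (ψ : EuclideanSpace ℝ (Fin N) → ℝ), IsSol Ω p lam α ψ → 0 < α :=
    fun lam h0 h1 α ψ hsol => by
      by_contra! hα
      exact h1.not_ge (Lam_le_of_isSol_of_nonpos hΩ.1 hΩ.2.2.1 hp1 h0 hα hsol)
  exact ⟨⟨_, hlt, hmain⟩, fun lam h0 h1 => hmain lam h0 (h1.trans_lt hlt)⟩

end
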